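/- arXiv:1504.00102 — 2 statements merged into one kernel-verified Lean document; each statement's English description precedes it below -/
import Mathlib

section
/- Fix y = (y₁,y₂,y₃) ∈ ℝ³ with y₃ > 0 and f = (f₁,f₂,f₃) ∈ ℝ³. Let vᵢ(x) = Σⱼ Sᵢⱼ(x,y) fⱼ − Σⱼ Sᵢⱼ(x,yᴵ) fᴵⱼ, where yᴵ = (y₁,y₂,−y₃) and fᴵ = (f₁,f₂,−f₃). Then for every x = (x₁,x₂,0) with x ≠ yᴵ, the normal component is v₃(x) = −(fᴵ₃/4π)·(1/|x−yᴵ|) − (y₃/4π)·Σⱼ fᴵⱼ (xⱼ−yᴵⱼ)/|x−yᴵ|³. -/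
open Real Finset

noncomputable section

/-- Points in three-dimensional Euclidean space. -/
abbrev E3 := EuclideanSpace ℝ (Fin 3)

/-- Partial derivative `∂f/∂xᵢ` of a scalar field on `ℝ³`. -/
def pd (i : Fin 3) (f : E3 → ℝ) (x : E3) : ℝ :=
  fderiv ℝ f x (EuclideanSpace.single i 1)

/-- Kronecker delta. -/
def kron (i j : Fin 3) : ℝ := if i = j then 1 else 0

/-- Reflected image point `yᴵ = (y₁, y₂, -y₃)`. -/
def reflPt (y : E3) : E3 := (EuclideanSpace.equiv (Fin 3) ℝ).symm ![y 0, y 1, -y 2]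

/-- Reflected vector `fᴵ = (f₁, f₂, -f₃)`. -/
def reflVec (f : Fin 3 → ℝ) : Fin 3 → ℝ := ![f 0, f 1, -f 2]

/-- Harmonic potential of a unit charge, `Gˢ(x,y) = 1/(4π|x-y|)`. -/
def GS (x y : E3) : ℝ := 1 / (4 * π * ‖x - y‖)

/-- Harmonic potential of a unit dipole with orientation `ν`:
`Gᴰ[ν](x,y) = Σᵢ νᵢ ∂/∂yᵢ Gˢ(x,y)`. -/
def GD (ν : Fin 3 → ℝ) (x y : E3) : ℝ := ∑ i, ν i * pd i (fun z => GS x z) y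

/-- Harmonic potential of a unit quadrupole with orientations `ν, κ`:
`G^Q[ν,κ](x,y) = Σᵢ Σⱼ νᵢ κⱼ ∂²/∂yᵢ∂yⱼ Gˢ(x,y)`. -/
def GQ (ν κ : Fin 3 → ℝ) (x y : E3) : ℝ :=
  ∑ i, ∑ j, ν i * κ j * pd i (fun z => pd j (fun w => GS x w) z) y

/-- The Stokeslet (single layer kernel)
`Sᵢⱼ(x,y) = (1/8π)[δᵢⱼ/|x-y| + (xᵢ-yᵢ)(xⱼ-yⱼ)/|x-y|³]`. -/
def stokeslet (x y : E3) (i j : Fin 3) : ℝ :=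
  (1 / (8 * π)) * (kron i j / ‖x - y‖ + (x i - y i) * (x j - y j) / ‖x - y‖ ^ 3)

/-- The velocity remaining after subtracting the reflected image Stokeslet:
`vᵢ(x) = Σⱼ Sᵢⱼ(x,y) fⱼ - Σⱼ Sᵢⱼ(x,yᴵ) fᴵⱼ`. -/
def vSt (y : E3) (f : Fin 3 → ℝ) (i : Fin 3) (x : E3) : ℝ :=
  (∑ j, stokeslet x y i j * f j) - ∑ j, stokeslet x (reflPt y) i j * reflVec f j

@[simp] lemma reflPt_zero (y : E3) : reflPt y 0 = y 0 := rfl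

@[simp] lemma reflPt_one (y : E3) : reflPt y 1 = y 1 := rfl

@[simp] lemma reflPt_two (y : E3) : reflPt y 2 = -y 2 := rfl

/-- Points of the plane `x₃ = 0` are equidistant from a point and its image. -/
lemma norm_sub_reflPt {x : E3} (hx : x 2 = 0) (y : E3) : ‖x - reflPt y‖ = ‖x - y‖ := by
  simp [EuclideanSpace.norm_eq, Fin.sum_univ_three, hx]

/-- on the plane `x₃ = 0` the normal component of the
Stokeslet-minus-image velocity is
`v₃(x) = -(fᴵ₃/4π)(1/|x-yᴵ|) - (y₃/4π) Σⱼ fᴵⱼ (xⱼ-yᴵⱼ)/|x-yᴵ|³`. -/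
theorem stokeslet_image_normal_component (y : E3) (hy : 0 < y 2) (f : Fin 3 → ℝ) :
    ∀ x : E3, x 2 = 0 → x ≠ reflPt y →
      vSt y f 2 x =
        -(reflVec f 2 / (4 * π)) * (1 / ‖x - reflPt y‖)
          - (y 2 / (4 * π)) * ∑ j, reflVec f j * (x j - reflPt y j) / ‖x - reflPt y‖ ^ 3 := by
  intro x hx _
  simp only [vSt, stokeslet, norm_sub_reflPt hx, Fin.sum_univ_three, reflPt_zero, reflPt_one,
    reflPt_two, hx]
  simp [kron, reflVec]
  ring
end
end

section
/- Fix y = (y₁,y₂,y₃) ∈ ℝ³ with y₃ > 0 and f ∈ ℝ³. Define uᵂᵢ(x) = Σⱼ Sᵢⱼ(x,y) fⱼ − Σⱼ Sᵢⱼ(x,yᴵ) fᴵⱼ − [x₃ ∂φ/∂xᵢ(x) − δᵢ₃ φ(x)], where φ(x) = fᴵ₃ Gˢ(x,yᴵ) + y₃ Gᴰ[fᴵ](x,yᴵ), and the corresponding pressure pᵂ(x) = Σⱼ Pⱼ(x,y) fⱼ − Σⱼ Pⱼ(x,yᴵ) fᴵⱼ − 2 ∂φ/∂x₃(x). Then (uᵂ,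 pᵂ) satisfies the Stokes equations Δuᵂ = ∇pᵂ and ∇·uᵂ = 0 at every point x of the open upper half-space {x₃ > 0} with x ≠ y. -/
open Real Finset

noncomputable section

/-- The Stokeslet pressure kernel `Pⱼ(x,y) = (1/4π)(xⱼ-yⱼ)/|x-y|³`. -/
def presKernel (x y : E3) (j : Fin 3) : ℝ := (1 / (4 * π)) * (x j - y j) / ‖x - y‖ ^ 3

/-- The Papkovich–Neuber potential for the Stokeslet image system:
`φ(x) = fᴵ₃ Gˢ(x,yᴵ) + y₃ Gᴰ[fᴵ](x,yᴵ)`. -/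
def phiS (y : E3) (f : Fin 3 → ℝ) (x : E3) : ℝ :=
  reflVec f 2 * GS x (reflPt y) + y 2 * GD (reflVec f) x (reflPt y)

/-- The half-space Stokeslet velocity
`uᵂᵢ(x) = Σⱼ Sᵢⱼ(x,y) fⱼ - Σⱼ Sᵢⱼ(x,yᴵ) fᴵⱼ - [x₃ ∂φ/∂xᵢ(x) - δᵢ₃ φ(x)]`. -/
def uW (y : E3) (f : Fin 3 → ℝ) (i : Fin 3) (x : E3) : ℝ :=
  (∑ j, stokeslet x y i j * f j) - (∑ j, stokeslet x (reflPt y) i j * reflVec f j)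
    - (x 2 * pd i (phiS y f) x - if i = 2 then phiS y f x else 0)

/-- The pressure corresponding to the half-space Stokeslet:
`pᵂ(x) = Σⱼ Pⱼ(x,y) fⱼ - Σⱼ Pⱼ(x,yᴵ) fᴵⱼ - 2 ∂φ/∂x₃(x)`. -/
def pW (y : E3) (f : Fin 3 → ℝ) (x : E3) : ℝ :=
  (∑ j, presKernel x y j * f j) - (∑ j, presKernel x (reflPt y) j * reflVec f j)
    - 2 * pd 2 (phiS y f) x

section PartialDerivatives

variable {U : Set E3} {φ ψ : E3 → ℝ} {x : E3}

lemma pd_add (i : Fin 3) (hφ : DifferentiableAt ℝ φ x) (hψ : DifferentiableAt ℝ ψ x) :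
    pd i (fun z => φ z + ψ z) x = pd i φ x + pd i ψ x := by
  simp [pd, fderiv_fun_add hφ hψ]

lemma pd_sub (i : Fin 3) (hφ : DifferentiableAt ℝ φ x) (hψ : DifferentiableAt ℝ ψ x) :
    pd i (fun z => φ z - ψ z) x = pd i φ x - pd i ψ x := by
  simp [pd, fderiv_fun_sub hφ hψ]

lemma pd_mul (i : Fin 3) (hφ : DifferentiableAt ℝ φ x) (hψ : DifferentiableAt ℝ ψ x) :
    pd i (fun z => φ z * ψ z) x = φ x * pd i ψ x + ψ x * pd i φ x := by
  simp [pd, fderiv_fun_mul hφ hψ]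

lemma pd_const_mul (i : Fin 3) (c : ℝ) (hφ : DifferentiableAt ℝ φ x) :
    pd i (fun z => c * φ z) x = c * pd i φ x := by
  simp [pd, fderiv_const_mul hφ c]

lemma pd_sum {ι : Type*} {s : Finset ι} {F : ι → E3 → ℝ} (i : Fin 3)
    (hF : ∀ k ∈ s, DifferentiableAt ℝ (F k) x) :
    pd i (fun z => ∑ k ∈ s, F k z) x = ∑ k ∈ s, pd i (F k) x := by
  simp [pd, fderiv_fun_sum hF]

lemma pd_comp {g : ℝ → ℝ} {g' : ℝ} (i : Fin 3) (hg : HasDerivAt g g' (φ x))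
    (hφ : DifferentiableAt ℝ φ x) : pd i (fun z => g (φ z)) x = g' * pd i φ x := by
  have h : HasFDerivAt (fun z => g (φ z)) (g' • fderiv ℝ φ x) x :=
    hg.comp_hasFDerivAt x hφ.hasFDerivAt
  simp [pd, h.fderiv]

lemma pd_coord (i j : Fin 3) (x : E3) : pd i (fun z => z j) x = if j = i then 1 else 0 := by
  have h : HasFDerivAt (fun z : E3 => z j) (EuclideanSpace.proj j : E3 →L[ℝ] ℝ) x :=
    (EuclideanSpace.proj j : E3 →L[ℝ] ℝ).hasFDerivAt
  simp [pd, h.fderiv]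

lemma analyticOnNhd_coord (j : Fin 3) : AnalyticOnNhd ℝ (fun z : E3 => z j) U := fun _ _ =>
  (EuclideanSpace.proj j : E3 →L[ℝ] ℝ).analyticAt _

lemma AnalyticOnNhd.pd (hφ : AnalyticOnNhd ℝ φ U) (i : Fin 3) : AnalyticOnNhd ℝ (pd i φ) U :=
  (ContinuousLinearMap.apply ℝ ℝ (EuclideanSpace.single i 1 : E3)).comp_analyticOnNhd hφ.fderiv

lemma pd_eqOn (hU : IsOpen U) (h : Set.EqOn φ ψ U) (i : Fin 3) :
    Set.EqOn (pd i φ) (pd i ψ) U := fun z hz => by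
  rw [pd, pd, (h.eventuallyEq_of_mem (hU.mem_nhds hz)).fderiv_eq]

lemma pd_comm (hφ : AnalyticAt ℝ φ x) (i j : Fin 3) :
    pd i (pd j φ) x = pd j (pd i φ) x := by
  have hd : DifferentiableAt ℝ (fderiv ℝ φ) x := hφ.fderiv.differentiableAt
  have key (k l : Fin 3) : pd k (pd l φ) x =
      fderiv ℝ (fderiv ℝ φ) x (EuclideanSpace.single k 1) (EuclideanSpace.single l 1) := by
    change fderiv ℝ (fun z => fderiv ℝ φ z (EuclideanSpace.single l 1)) x _ = _
    rw [fderiv_clm_apply hd (differentiableAt_const _)]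
    simp
  rw [key, key]
  have hs : IsSymmSndFDerivAt ℝ φ x :=
    (hφ.contDiffAt (n := ⊤)).isSymmSndFDerivAt (by simp)
  exact hs _ _

end PartialDerivatives

/-- `φ` is real-analytic and harmonic on `U`. -/
structure IsHarmonicOn (φ : E3 → ℝ) (U : Set E3) : Prop where
  analytic : AnalyticOnNhd ℝ φ U
  laplacian_eq_zero : ∀ x ∈ U, ∑ j, pd j (pd j φ) x = 0

/-- The velocity `u` and the pressure `p` are real-analytic and solve the Stokes equations with
unit viscosity on `U`. -/
structure IsStokesOn (u : Fin 3 → E3 → ℝ) (p : E3 → ℝ) (U : Set E3) : Prop where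
  analytic_velocity : ∀ i, AnalyticOnNhd ℝ (u i) U
  analytic_pressure : AnalyticOnNhd ℝ p U
  momentum : ∀ x ∈ U, ∀ i, ∑ j, pd j (pd j (u i)) x = pd i p x
  divergence : ∀ x ∈ U, ∑ i, pd i (u i) x = 0

section Harmonic

variable {U V : Set E3} {φ ψ : E3 → ℝ}

lemma IsHarmonicOn.mono (hφ : IsHarmonicOn φ V) (h : U ⊆ V) : IsHarmonicOn φ U :=
  ⟨hφ.analytic.mono h, fun x hx => hφ.laplacian_eq_zero x (h hx)⟩

lemma IsHarmonicOn.add (hU : IsOpen U) (hφ : IsHarmonicOn φ U) (hψ : IsHarmonicOn ψ U) :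
    IsHarmonicOn (fun x => φ x + ψ x) U := by
  refine ⟨hφ.analytic.add hψ.analytic, fun x hx => ?_⟩
  have h1 (j : Fin 3) : Set.EqOn (pd j fun x => φ x + ψ x) (fun x => pd j φ x + pd j ψ x) U :=
    fun z hz => pd_add j (hφ.analytic z hz).differentiableAt (hψ.analytic z hz).differentiableAt
  have h2 (j : Fin 3) : pd j (pd j fun x => φ x + ψ x) x = pd j (pd j φ) x + pd j (pd j ψ) x := by
    rw [pd_eqOn hU (h1 j) j hx, pd_add j (hφ.analytic.pd j x hx).differentiableAt
      (hψ.analytic.pd j x hx).differentiableAt]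
  simp_rw [h2, Finset.sum_add_distrib, hφ.laplacian_eq_zero x hx, hψ.laplacian_eq_zero x hx,
    add_zero]

lemma IsHarmonicOn.const_mul (hU : IsOpen U) (hφ : IsHarmonicOn φ U) (c : ℝ) :
    IsHarmonicOn (fun x => c * φ x) U := by
  refine ⟨analyticOnNhd_const.mul hφ.analytic, fun x hx => ?_⟩
  have h1 (j : Fin 3) : Set.EqOn (pd j fun x => c * φ x) (fun x => c * pd j φ x) U :=
    fun z hz => pd_const_mul j c (hφ.analytic z hz).differentiableAt
  have h2 (j : Fin 3) : pd j (pd j fun x => c * φ x) x = c * pd j (pd j φ) x := by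
    rw [pd_eqOn hU (h1 j) j hx, pd_const_mul j c (hφ.analytic.pd j x hx).differentiableAt]
  simp_rw [h2, ← Finset.mul_sum, hφ.laplacian_eq_zero x hx, mul_zero]

lemma isHarmonicOn_pd (hU : IsOpen U) (hφ : IsHarmonicOn φ U) (i : Fin 3) :
    IsHarmonicOn (pd i φ) U := by
  refine ⟨hφ.analytic.pd i, fun x hx => ?_⟩
  have h (j : Fin 3) : pd j (pd j (pd i φ)) x =
      pd i (pd j (pd j φ)) x := by
    rw [pd_eqOn hU (fun z hz => pd_comm (hφ.analytic z hz) j i) j hx,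
      pd_comm (hφ.analytic.pd j x hx)]
  simp_rw [h]
  rw [← pd_sum i fun j _ => ((hφ.analytic.pd j).pd j x hx).differentiableAt,
    pd_eqOn hU (fun z hz => hφ.laplacian_eq_zero z hz) i hx]
  simp [pd]

end Harmonic

section Stokes

variable {U : Set E3} {u v : Fin 3 → E3 → ℝ} {p q φ : E3 → ℝ}

lemma IsStokesOn.add (hU : IsOpen U) (hu : IsStokesOn u p U) (hv : IsStokesOn v q U) :
    IsStokesOn (fun i x => u i x + v i x) (fun x => p x + q x) U := by
  have hud (i : Fin 3) {z : E3} (hz : z ∈ U) := (hu.analytic_velocity i z hz).differentiableAt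
  have hvd (i : Fin 3) {z : E3} (hz : z ∈ U) := (hv.analytic_velocity i z hz).differentiableAt
  have h1 (i j : Fin 3) :
      Set.EqOn (pd j fun x => u i x + v i x) (fun x => pd j (u i) x + pd j (v i) x) U :=
    fun z hz => pd_add j (hud i hz) (hvd i hz)
  refine ⟨fun i => (hu.analytic_velocity i).add (hv.analytic_velocity i),
    hu.analytic_pressure.add hv.analytic_pressure, fun x hx i => ?_, fun x hx => ?_⟩
  · have h2 (j : Fin 3) : pd j (pd j fun x => u i x + v i x) x =
        pd j (pd j (u i)) x + pd j (pd j (v i)) x := by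
      rw [pd_eqOn hU (h1 i j) j hx,
        pd_add j ((hu.analytic_velocity i).pd j x hx).differentiableAt
          ((hv.analytic_velocity i).pd j x hx).differentiableAt]
    simp_rw [h2, Finset.sum_add_distrib, hu.momentum x hx, hv.momentum x hx]
    rw [pd_add i (hu.analytic_pressure x hx).differentiableAt
      (hv.analytic_pressure x hx).differentiableAt]
  · simp_rw [h1 _ _ hx, Finset.sum_add_distrib, hu.divergence x hx, hv.divergence x hx, add_zero]

lemma IsStokesOn.congr (hU : IsOpen U) (hu : IsStokesOn u p U) (huv : ∀ i, Set.EqOn (v i) (u i) U)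
    (hpq : Set.EqOn q p U) : IsStokesOn v q U where
  analytic_velocity i := (hu.analytic_velocity i).congr hU (huv i).symm
  analytic_pressure := hu.analytic_pressure.congr hU hpq.symm
  momentum x hx i := by
    simp_rw [pd_eqOn hU (pd_eqOn hU (huv i) _) _ hx, pd_eqOn hU hpq i hx, hu.momentum x hx i]
  divergence x hx := by simp_rw [pd_eqOn hU (huv _) _ hx, hu.divergence x hx]

/-- The Papkovich–Neuber representation: an affine function `∑ j, a j * x j + b` and a harmonic
potential `φ` generate a Stokes flow. -/
lemma IsHarmonicOn.isStokesOn (hU : IsOpen U) (hφ : IsHarmonicOn φ U) (a : Fin 3 → ℝ) (b : ℝ) :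
    IsStokesOn (fun i x => a i * φ x - ((∑ j, a j * x j) + b) * pd i φ x)
      (fun x => -2 * ∑ j, a j * pd j φ x) U := by
  set L : E3 → ℝ := fun x => (∑ j, a j * x j) + b with hL
  have hLan : AnalyticOnNhd ℝ L U := by
    refine AnalyticOnNhd.add ?_ analyticOnNhd_const
    exact Finset.analyticOnNhd_fun_sum _ fun j _ =>
      analyticOnNhd_const.mul (analyticOnNhd_coord j)
  have hLpd (k : Fin 3) (x : E3) : pd k L x = a k := by
    have hc (j : Fin 3) : DifferentiableAt ℝ (fun z : E3 => z j) x :=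
      (analyticOnNhd_coord j x (Set.mem_univ x)).differentiableAt
    rw [hL, pd_add k (by fun_prop) (by fun_prop), pd_sum k (fun j _ => (hc j).const_mul _)]
    simp_rw [pd_const_mul k _ (hc _), pd_coord]
    simp [pd]
  have hφd {z : E3} (hz : z ∈ U) : DifferentiableAt ℝ φ z := (hφ.analytic z hz).differentiableAt
  have hLd {z : E3} (hz : z ∈ U) : DifferentiableAt ℝ L z := (hLan z hz).differentiableAt
  have hd1 (i : Fin 3) {z : E3} (hz : z ∈ U) : DifferentiableAt ℝ (pd i φ) z :=
    (hφ.analytic.pd i z hz).differentiableAt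
  have hd2 (j i : Fin 3) {z : E3} (hz : z ∈ U) : DifferentiableAt ℝ (pd j (pd i φ)) z :=
    ((hφ.analytic.pd i).pd j z hz).differentiableAt
  have h1 (i j : Fin 3) : Set.EqOn (pd j fun x => a i * φ x - L x * pd i φ x)
      (fun x => a i * pd j φ x - (L x * pd j (pd i φ) x + a j * pd i φ x)) U := fun z hz => by
    rw [pd_sub j ((hφd hz).const_mul _) ((hLd hz).fun_mul (hd1 i hz)), pd_const_mul j _ (hφd hz),
      pd_mul j (hLd hz) (hd1 i hz), hLpd, mul_comm (pd i φ z)]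
  refine ⟨fun i => (analyticOnNhd_const.mul hφ.analytic).sub (hLan.mul (hφ.analytic.pd i)),
    analyticOnNhd_const.mul (Finset.analyticOnNhd_fun_sum _ fun j _ =>
      analyticOnNhd_const.mul (hφ.analytic.pd j)), fun x hx i => ?_, fun x hx => ?_⟩
  · have h2 (j : Fin 3) : pd j (pd j fun x => a i * φ x - L x * pd i φ x) x =
        a i * pd j (pd j φ) x - L x * pd j (pd j (pd i φ)) x - 2 * (a j * pd j (pd i φ) x) := by
      rw [pd_eqOn hU (h1 i j) j hx, pd_sub j ((hd1 j hx).const_mul _)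
        (((hLd hx).fun_mul (hd2 j i hx)).fun_add ((hd1 i hx).const_mul _)), pd_const_mul j _ (hd1 j hx),
        pd_add j ((hLd hx).fun_mul (hd2 j i hx)) ((hd1 i hx).const_mul _),
        pd_mul j (hLd hx) (hd2 j i hx), pd_const_mul j _ (hd1 i hx), hLpd]
      ring
    refine (Finset.sum_congr rfl fun j _ => h2 j).trans ?_
    simp_rw [Finset.sum_sub_distrib, ← Finset.mul_sum, hφ.laplacian_eq_zero x hx,
      (isHarmonicOn_pd hU hφ i).laplacian_eq_zero x hx]
    rw [pd_const_mul i _ (DifferentiableAt.fun_sum fun j _ => (hd1 j hx).const_mul _),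
      pd_sum i fun j _ => (hd1 j hx).const_mul _]
    simp_rw [pd_const_mul i _ (hd1 _ hx), pd_comm (hφ.analytic x hx) i]
    ring
  · have h (i : Fin 3) : pd i (fun x => a i * φ x - L x * pd i φ x) x =
        -L x * pd i (pd i φ) x := by
      rw [h1 i i hx]
      ring
    refine (Finset.sum_congr rfl fun i _ => h i).trans ?_
    rw [← Finset.mul_sum, hφ.laplacian_eq_zero x hx, mul_zero]

end Stokes

section PointCharge

lemma norm_sub_sq_eq (x y : E3) : ‖x - y‖ ^ 2 = ∑ j, (x j - y j) ^ 2 := by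
  simp [EuclideanSpace.norm_sq_eq]

lemma analyticAt_inv_norm_sub {x y : E3} (h : x ≠ y) :
    AnalyticAt ℝ (fun z : E3 => ‖z - y‖⁻¹) x := by
  have hn : ContDiffAt ℝ ⊤ (fun z : E3 => ‖z - y‖) x :=
    ContDiffAt.norm ℝ (contDiffAt_id.sub contDiffAt_const) (sub_ne_zero.2 h)
  exact (hn.inv (norm_ne_zero_iff.2 (sub_ne_zero.2 h))).analyticAt

lemma pd_inv_norm_sub {x y : E3} (h : x ≠ y) (i : Fin 3) :
    pd i (fun z : E3 => ‖z - y‖⁻¹) x = (y i - x i) * ‖x - y‖⁻¹ ^ 3 := by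
  have hr : ‖x - y‖ ≠ 0 := norm_ne_zero_iff.2 (sub_ne_zero.2 h)
  have hsq : HasFDerivAt (fun z : E3 => ‖z - y‖ ^ 2) (2 • innerSL ℝ (x - y)) x := by
    simpa using ((hasFDerivAt_id x).sub_const y).norm_sq
  have hdn : DifferentiableAt ℝ (fun z : E3 => ‖z - y‖) x :=
    DifferentiableAt.norm ℝ (differentiableAt_id.sub_const y) (sub_ne_zero.2 h)
  have hn : pd i (fun z : E3 => ‖z - y‖ * ‖z - y‖) x = 2 * (x i - y i) := by
    simp_rw [← sq]
    rw [pd, hsq.fderiv]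
    simp [EuclideanSpace.inner_single_right]
  rw [pd_mul i hdn hdn] at hn
  have hinv : pd i (fun z : E3 => ‖z - y‖⁻¹) x =
      -(‖x - y‖ ^ 2)⁻¹ * pd i (fun z : E3 => ‖z - y‖) x :=
    pd_comp i (hasDerivAt_inv hr) hdn
  rw [hinv]
  field_simp
  linarith

lemma isHarmonicOn_inv_norm_sub (y : E3) :
    IsHarmonicOn (fun x : E3 => ‖x - y‖⁻¹) {y}ᶜ := by
  refine ⟨fun x hx => analyticAt_inv_norm_sub hx, fun x hx => ?_⟩
  have hr : ‖x - y‖ ≠ 0 := norm_ne_zero_iff.2 (sub_ne_zero.2 hx)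
  have hd : DifferentiableAt ℝ (fun z : E3 => ‖z - y‖⁻¹) x :=
    (analyticAt_inv_norm_sub hx).differentiableAt
  have hc (j : Fin 3) : DifferentiableAt ℝ (fun z : E3 => z j) x :=
    (analyticOnNhd_coord j x (Set.mem_univ x)).differentiableAt
  have hpow (j : Fin 3) : pd j (fun z : E3 => ‖z - y‖⁻¹ ^ 3) x =
      3 * ‖x - y‖⁻¹ ^ 2 * ((y j - x j) * ‖x - y‖⁻¹ ^ 3) := by
    rw [← pd_inv_norm_sub hx j]
    simpa using pd_comp j (hasDerivAt_pow 3 _) hd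
  have hlin (j : Fin 3) : pd j (fun z : E3 => y j - z j) x = -1 := by
    rw [pd_sub j (differentiableAt_const _) (hc j), pd_coord]
    simp [pd]
  have h (j : Fin 3) : pd j (pd j fun z : E3 => ‖z - y‖⁻¹) x =
      3 * ‖x - y‖⁻¹ ^ 5 * (x j - y j) ^ 2 - ‖x - y‖⁻¹ ^ 3 := by
    rw [pd_eqOn isOpen_compl_singleton (fun z hz => pd_inv_norm_sub hz j) j hx,
      pd_mul j ((hc j).const_sub _) (hd.fun_pow 3), hpow, hlin]
    ring
  simp_rw [h, Finset.sum_sub_distrib, ← Finset.mul_sum, ← norm_sub_sq_eq]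
  simp
  field_simp
  ring

lemma GS_eq (x y : E3) : GS x y = (4 * π)⁻¹ * ‖x - y‖⁻¹ := by
  rw [GS, one_div, mul_inv]

lemma isHarmonicOn_GS (y : E3) : IsHarmonicOn (fun x => GS x y) {y}ᶜ := by
  simp_rw [GS_eq]
  exact (isHarmonicOn_inv_norm_sub y).const_mul isOpen_compl_singleton _

lemma pd_GS {x y : E3} (h : x ≠ y) (i : Fin 3) :
    pd i (fun z => GS z y) x = -((4 * π)⁻¹ * (x i - y i) * ‖x - y‖⁻¹ ^ 3) := by
  simp_rw [GS_eq]
  rw [pd_const_mul i _ (analyticAt_inv_norm_sub h).differentiableAt, pd_inv_norm_sub h]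
  ring

/-- Differentiating in the source point is minus differentiating in the target point. -/
lemma pd_GS_source {x y : E3} (h : x ≠ y) (i : Fin 3) :
    pd i (fun z => GS x z) y = -1 * pd i (fun z => GS z y) x := by
  have hsymm : (fun z => GS x z) = fun z => GS z x := by
    funext z
    rw [GS, GS, norm_sub_rev]
  rw [hsymm, pd_GS h, pd_GS h.symm, norm_sub_rev]
  ring

lemma isHarmonicOn_GD (ν : Fin 3 → ℝ) (y : E3) : IsHarmonicOn (fun x => GD ν x y) {y}ᶜ := by
  have hU : IsOpen ({y}ᶜ : Set E3) := isOpen_compl_singleton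
  have h (i : Fin 3) : IsHarmonicOn (fun x => ν i * (-1 * pd i (fun z => GS z y) x)) {y}ᶜ :=
    ((isHarmonicOn_pd hU (isHarmonicOn_GS y) i).const_mul hU _).const_mul hU _
  have hsum := ((h 0).add hU (h 1)).add hU (h 2)
  have heq : Set.EqOn (fun x => GD ν x y) (fun x => ν 0 * (-1 * pd 0 (fun z => GS z y) x) +
      ν 1 * (-1 * pd 1 (fun z => GS z y) x) + ν 2 * (-1 * pd 2 (fun z => GS z y) x)) {y}ᶜ := by
    intro x hx
    simp only [GD, pd_GS_source hx, Fin.sum_univ_three]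
  refine ⟨hsum.analytic.congr hU heq.symm, fun x hx => ?_⟩
  simp_rw [pd_eqOn hU (pd_eqOn hU heq _) _ hx]
  exact hsum.laplacian_eq_zero x hx

lemma isHarmonicOn_phiS (y : E3) (f : Fin 3 → ℝ) : IsHarmonicOn (phiS y f) {reflPt y}ᶜ :=
  ((isHarmonicOn_GS _).const_mul isOpen_compl_singleton _).add isOpen_compl_singleton
    ((isHarmonicOn_GD _ _).const_mul isOpen_compl_singleton _)

/-- The free-space Stokeslet solves the Stokes equations away from the source. -/
lemma isStokesOn_stokeslet {y : E3} {U : Set E3} (hU : IsOpen U) (hy : U ⊆ {y}ᶜ)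
    (f : Fin 3 → ℝ) : IsStokesOn (fun i x => ∑ j, stokeslet x y i j * f j)
      (fun x => ∑ j, presKernel x y j * f j) U := by
  have hG := (isHarmonicOn_GS y).mono hy
  have hpd {x : E3} (hx : x ∈ U) (i : Fin 3) : pd i (fun z => 2⁻¹ * GS z y) x =
      2⁻¹ * -((4 * π)⁻¹ * (x i - y i) * ‖x - y‖⁻¹ ^ 3) := by
    rw [pd_const_mul i _ (hG.analytic x hx).differentiableAt, pd_GS (hy hx)]
  refine ((hG.const_mul hU 2⁻¹).isStokesOn hU f (-∑ j, f j * y j)).congr hU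
    (fun i x hx => ?_) fun x hx => ?_
  · simp only [hpd hx]
    simp only [GS_eq, stokeslet, kron, Fin.sum_univ_three]
    fin_cases i <;> simp <;> ring
  · simp only [hpd hx, presKernel, Fin.sum_univ_three]
    ring

end PointCharge

/-- the half-space Stokeslet pair `(uᵂ, pᵂ)` satisfies the Stokes
equations in the open upper half-space away from the source. -/
theorem stokeslet_halfspace_satisfies_stokes (y : E3) (hy : 0 < y 2) (f : Fin 3 → ℝ) :
    ∀ x : E3, 0 < x 2 → x ≠ y →
      (∀ i, ∑ j, pd j (pd j (uW y f i)) x = pd i (pW y f) x) ∧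
      (∑ i, pd i (uW y f i) x = 0) := by
  intro x hx hxy
  have hrefl : reflPt y 2 = -y 2 := rfl
  set U : Set E3 := {y}ᶜ ∩ {reflPt y}ᶜ
  have hU : IsOpen U := isOpen_compl_singleton.inter isOpen_compl_singleton
  have hxU : x ∈ U := by
    refine ⟨hxy, fun h => ?_⟩
    have h2 : x 2 = reflPt y 2 := congrArg (fun z : E3 => z 2) h
    linarith
  have hsource := isStokesOn_stokeslet hU Set.inter_subset_left f
  have himage := isStokesOn_stokeslet hU Set.inter_subset_right (fun j => -reflVec f j)
  have hwall := ((isHarmonicOn_phiS y f).mono (Set.inter_subset_right : U ⊆ _)).isStokesOn hU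
    ![0, 0, 1] 0
  have hmain : IsStokesOn (uW y f) (pW y f) U := by
    refine ((hsource.add hU himage).add hU hwall).congr hU (fun i z _ => ?_) fun z _ => ?_
    · fin_cases i <;> simp [uW, Fin.sum_univ_three] <;> ring
    · simp [pW, Fin.sum_univ_three]
      ring
  exact ⟨hmain.momentum x hxU, hmain.divergence x hxU⟩
end
end
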